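/- g_{D,𝒯} is the free 𝒯-multiple prelie algebra generated by D: for any 𝒯-multiple prelie algebra (A, (•_t)_{t∈𝒯}) and any family (a_d)_{d∈D} of elements of A, there exists a unique linear map φ : g_{D,𝒯} → A such that φ(x •_t y) = φ(x) •_t φ(y) for all x, y ∈ g_{D,𝒯} and all t ∈ 𝒯, and φ sends the single-vertex tree decorated by d to a_d for every d ∈ D. -/

import Mathlib

open scoped TensorProduct

/-- Underlying data of a `D`-decorated `T`-typed rooted tree: a root decoration together with a
list of pairs (edge type, subtree). -/
inductive PreTree (D T : Type) : Type
  | node : D → List (T × PreTree D T) → PreTree D T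

namespace PreTree
variable {D T : Type}

/-- One-step rearrangement of children; it generates the identification of trees whose children
form the same multiset of (type, subtree) pairs. -/
inductive Swap : PreTree D T → PreTree D T → Prop
  | swap (d : D) (l₁ l₂ : List (T × PreTree D T)) (p q : T × PreTree D T) :
      Swap (.node d (l₁ ++ p :: q :: l₂)) (.node d (l₁ ++ q :: p :: l₂))
  | congr (d : D) (l₁ l₂ : List (T × PreTree D T)) (t : T) (s s' : PreTree D T) :
      Swap s s' → Swap (.node d (l₁ ++ (t, s) :: l₂)) (.node d (l₁ ++ (t, s') :: l₂))

end PreTree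

instance preTreeSetoid (D T : Type) : Setoid (PreTree D T) :=
  ⟨Relation.EqvGen PreTree.Swap, Relation.EqvGen.is_equivalence _⟩

/-- `D`-decorated `T`-typed rooted trees: the root is decorated by an element of `D` and carries
a finite multiset of pairs (type, subtree). -/
abbrev TypedTree (D T : Type) : Type := Quotient (preTreeSetoid D T)
namespace PreTree
variable {D T : Type}

mutual
/-- The list of all graftings `S •_t^{(v)} S'` of `S'` on a vertex `v` of `S`, the new edge
having type `t` (one entry for each vertex `v` of `S`). -/
def graftAll (t : T) (s' : PreTree D T) : PreTree D T → List (PreTree D T)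
  | .node d l => .node d ((t, s') :: l) :: (graftAllL t s' l).map (fun l' => .node d l')
def graftAllL (t : T) (s' : PreTree D T) :
    List (T × PreTree D T) → List (List (T × PreTree D T))
  | [] => []
  | (u, c) :: rest =>
      ((graftAll t s' c).map fun c' => (u, c') :: rest) ++
      ((graftAllL t s' rest).map fun r => (u, c) :: r)
end

end PreTree

variable (K : Type) [Field K]

/-- `g_{D,T}`: the free `K`-vector space with basis the set of `D`-decorated `T`-typed
rooted trees. -/
abbrev gDT (K D T : Type) [Field K] : Type := TypedTree D T →₀ K

/-- The grafting product `•_t`, defined on basis trees by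
`S •_t S' = Σ_{v ∈ V(S)} S •_t^{(v)} S'`, extended bilinearly. -/
noncomputable def bulletL {D T : Type} (t : T) :
    gDT K D T →ₗ[K] gDT K D T →ₗ[K] gDT K D T :=
  Finsupp.lift (gDT K D T →ₗ[K] gDT K D T) K (TypedTree D T) fun a =>
    Finsupp.lift (gDT K D T) K (TypedTree D T) fun b =>
      ((PreTree.graftAll t b.out a.out).map
        fun r => Finsupp.single (⟦r⟧ : TypedTree D T) (1 : K)).sum

section Brace

variable {K : Type} [Field K] {T A : Type} [AddCommGroup A] [Module K A]

/-- The sum of the values of `f` on the lists obtained from a list of typed elements by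
replacing one entry `(u, c)` with `(u, c •_t y)`, where `p = (t, y)`. -/
def derivSum (mul : T → A →ₗ[K] A →ₗ[K] A) (p : T × A) :
    (List (T × A) → A) → List (T × A) → A
  | _, [] => 0
  | f, q :: l => f ((q.1, mul p.1 q.2 p.2) :: l) + derivSum mul p (fun l' => f (q :: l')) l

/-- Additivity of a function of lists of typed elements in each entry. -/
def MultiAdditive (f : List (T × A) → A) : Prop :=
  ∀ (l₁ : List (T × A)) (u : T) (b c : A) (l₂ : List (T × A)),
    f (l₁ ++ (u, b + c) :: l₂) = f (l₁ ++ (u, b) :: l₂) + f (l₁ ++ (u, c) :: l₂)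

/-- Invariance of a function of lists under the exchange of two consecutive entries. -/
def SwapInvariant (f : List (T × A) → A) : Prop :=
  ∀ (l₁ : List (T × A)) (p q : T × A) (l₂ : List (T × A)),
    f (l₁ ++ p :: q :: l₂) = f (l₁ ++ q :: p :: l₂)

/-- The symmetric brace `x{p₁, …, pₙ}`, defined by the Guin–Oudom recursion; it vanishes on lists
of length different from `n`. -/
def brace (mul : T → A →ₗ[K] A →ₗ[K] A) (x : A) : ℕ → List (T × A) → A
  | 0, [] => x
  | 0, _ :: _ => 0
  | _ + 1, [] => 0
  | n + 1, p :: l => mul p.1 (brace mul x n l) p.2 - derivSum mul p (brace mul x n) l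

lemma MultiAdditive.cons {f : List (T × A) → A} (hf : MultiAdditive f) (q : T × A) :
    MultiAdditive fun l => f (q :: l) :=
  fun l₁ => hf (q :: l₁)

lemma MultiAdditive.map_zero {f : List (T × A) → A} (hf : MultiAdditive f) (u : T)
    (l : List (T × A)) : f ((u, 0) :: l) = 0 := by
  simpa using hf [] u 0 0 l

lemma MultiAdditive.map_sum {f : List (T × A) → A} (hf : MultiAdditive f) (u : T)
    (l : List (T × A)) (s : List A) :
    f ((u, s.sum) :: l) = (s.map fun b => f ((u, b) :: l)).sum := by
  induction s with
  | nil => simpa using hf.map_zero u l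
  | cons b s ih =>
    have := hf [] u b s.sum l
    simp_all

variable (mul : T → A →ₗ[K] A →ₗ[K] A)

lemma derivSum_add (p : T × A) (f g : List (T × A) → A) (l : List (T × A)) :
    derivSum mul p (fun l' => f l' + g l') l = derivSum mul p f l + derivSum mul p g l := by
  induction l generalizing f g with
  | nil => simp [derivSum]
  | cons q l ih => simp only [derivSum, ih]; abel

lemma derivSum_sub (p : T × A) (f g : List (T × A) → A) (l : List (T × A)) :
    derivSum mul p (fun l' => f l' - g l') l = derivSum mul p f l - derivSum mul p g l := by
  induction l generalizing f g with
  | nil => simp [derivSum]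
  | cons q l ih => simp only [derivSum, ih]; abel

lemma derivSum_zero (p : T × A) (l : List (T × A)) :
    derivSum mul p (fun _ => 0) l = 0 := by
  induction l with
  | nil => simp [derivSum]
  | cons q l ih => simp [derivSum, ih]

lemma derivSum_mul (p q : T × A) (f : List (T × A) → A) (l : List (T × A)) :
    derivSum mul p (fun l' => mul q.1 (f l') q.2) l = mul q.1 (derivSum mul p f l) q.2 := by
  induction l generalizing f with
  | nil => simp [derivSum]
  | cons r l ih => simp [derivSum, ih]

lemma derivSum_add_left {f : List (T × A) → A} (hf : MultiAdditive f) (u : T) (b c : A)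
    (l : List (T × A)) :
    derivSum mul (u, b + c) f l = derivSum mul (u, b) f l + derivSum mul (u, c) f l := by
  induction l generalizing f with
  | nil => simp [derivSum]
  | cons q l ih =>
    have := hf [] q.1 (mul u q.2 b) (mul u q.2 c) l
    simp only [List.nil_append] at this
    simp only [derivSum, ih (hf.cons q), map_add, this]
    abel

lemma MultiAdditive.derivSum (p : T × A) {f : List (T × A) → A} (hf : MultiAdditive f) :
    MultiAdditive (derivSum mul p f) := by
  intro l₁
  induction l₁ generalizing f with
  | nil =>
    intro u b c l₂
    have h := hf [] u (mul p.1 b p.2) (mul p.1 c p.2) l₂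
    have h' : (fun l' => f ((u, b + c) :: l'))
        = fun l' => f ((u, b) :: l') + f ((u, c) :: l') := funext fun l' => hf [] u b c l'
    simp only [List.nil_append] at h ⊢
    simp only [_root_.derivSum, map_add, LinearMap.add_apply, h, h', derivSum_add]
    abel
  | cons q l₁ ih =>
    intro u b c l₂
    have h := hf ((q.1, mul p.1 q.2 p.2) :: l₁) u b c l₂
    simp only [List.cons_append] at h ⊢
    simp only [_root_.derivSum, h, ih (hf.cons q)]
    abel

lemma SwapInvariant.derivSum (r : T × A) {f : List (T × A) → A} (hf : SwapInvariant f) :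
    SwapInvariant (derivSum mul r f) := by
  intro l₁
  induction l₁ generalizing f with
  | nil =>
    intro p q l₂
    have h₁ := hf [] (p.1, mul r.1 p.2 r.2) q l₂
    have h₂ := hf [] p (q.1, mul r.1 q.2 r.2) l₂
    have h₃ : (fun l' => f (p :: q :: l')) = fun l' => f (q :: p :: l') :=
      funext fun l' => hf [] p q l'
    simp only [List.nil_append] at h₁ h₂ ⊢
    simp only [_root_.derivSum, h₁, h₂, h₃]
    abel
  | cons q l₁ ih =>
    intro p p' l₂
    have h := hf ((q.1, mul r.1 q.2 r.2) :: l₁) p p' l₂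
    simp only [List.cons_append] at h ⊢
    simp only [_root_.derivSum, h, ih (f := fun l => f (q :: l)) (fun l => hf (q :: l)) p p' l₂]

lemma multiAdditive_brace (x : A) (n : ℕ) : MultiAdditive (brace mul x n) := by
  induction n with
  | zero => rintro (_ | ⟨q, l₁⟩) u b c l₂ <;> simp [brace]
  | succ n ih =>
    rintro (_ | ⟨q, l₁⟩) u b c l₂
    · simp only [List.nil_append, brace, map_add, derivSum_add_left mul ih]
      abel
    · simp only [List.cons_append, brace, ih l₁ u b c l₂, ih.derivSum mul q l₁ u b c l₂,
        map_add, LinearMap.add_apply]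
      abel

variable {mul}

lemma derivSum_comm
    (hmul : ∀ (t t' : T) (x y z : A),
      mul t' x (mul t y z) - mul t (mul t' x y) z =
        mul t x (mul t' z y) - mul t' (mul t x z) y)
    (p q : T × A) {f : List (T × A) → A} (hf : MultiAdditive f)
    (l : List (T × A)) :
    derivSum mul p (derivSum mul q f) l + derivSum mul (q.1, mul p.1 q.2 p.2) f l =
      derivSum mul q (derivSum mul p f) l + derivSum mul (p.1, mul q.1 p.2 q.2) f l := by
  induction l generalizing f with
  | nil => simp [derivSum]
  | cons c l ih =>
    have h := ih (hf.cons c)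
    have h₁ := hf [] c.1 (mul q.1 (mul p.1 c.2 p.2) q.2) (mul q.1 c.2 (mul p.1 q.2 p.2)) l
    have h₂ := hf [] c.1 (mul p.1 (mul q.1 c.2 q.2) p.2) (mul p.1 c.2 (mul q.1 p.2 q.2)) l
    have h₃ : mul q.1 (mul p.1 c.2 p.2) q.2 + mul q.1 c.2 (mul p.1 q.2 p.2) =
        mul p.1 (mul q.1 c.2 q.2) p.2 + mul p.1 c.2 (mul q.1 p.2 q.2) := by
      have := hmul p.1 q.1 c.2 q.2 p.2
      grind
    rw [h₃] at h₁
    have h₄ := h₁.symm.trans h₂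
    simp only [List.nil_append] at h₄
    simp only [derivSum, derivSum_add]
    grind

lemma swapInvariant_brace
    (hmul : ∀ (t t' : T) (x y z : A),
      mul t' x (mul t y z) - mul t (mul t' x y) z =
        mul t x (mul t' z y) - mul t' (mul t x z) y)
    (x : A) (n : ℕ) : SwapInvariant (brace mul x n) := by
  induction n with
  | zero => rintro (_ | ⟨r, l₁⟩) p q l₂ <;> simp [brace]
  | succ n ih =>
    rintro (_ | ⟨r, l₁⟩) p q l₂
    · cases n with
      | zero => simp [brace, derivSum, derivSum_zero]
      | succ n =>
        have h := derivSum_comm hmul p q (multiAdditive_brace mul x n) l₂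
        have h' := hmul p.1 q.1 (brace mul x n l₂) q.2 p.2
        simp only [List.nil_append, brace, derivSum, derivSum_sub, derivSum_mul, map_sub,
          LinearMap.sub_apply]
        grind
    · simp only [List.cons_append, brace, ih l₁ p q l₂, ih.derivSum mul r l₁ p q l₂]

end Brace

namespace PreTree

variable {D T : Type}

section Invariants

/-- The number of children of the root. -/
def arity : PreTree D T → ℕ
  | .node _ l => l.length

/-- The tree obtained by attaching a new child to the root. -/
def addChild (p : T × PreTree D T) : PreTree D T → PreTree D T
  | .node d l => .node d (p :: l)

mutual
/-- The number of vertices of a tree. -/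
def numVertices : PreTree D T → ℕ
  | .node _ l => 1 + numVerticesL l
/-- The number of vertices of a forest. -/
def numVerticesL : List (T × PreTree D T) → ℕ
  | [] => 0
  | (_, c) :: rest => numVertices c + numVerticesL rest
end

lemma numVerticesL_append (l₁ l₂ : List (T × PreTree D T)) :
    numVerticesL (l₁ ++ l₂) = numVerticesL l₁ + numVerticesL l₂ := by
  induction l₁ with
  | nil => simp [numVerticesL]
  | cons p l ih => simp [numVerticesL, ih, add_assoc]

lemma eq_of_equiv {α : Type} (f : PreTree D T → α) (hf : ∀ a b, Swap a b → f a = f b)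
    {a b : PreTree D T} (h : a ≈ b) : f a = f b := by
  have h' : Relation.EqvGen Swap a b := h
  clear h
  induction h' with
  | rel a b h => exact hf a b h
  | refl => rfl
  | symm _ _ _ ih => exact ih.symm
  | trans _ _ _ _ _ ih₁ ih₂ => exact ih₁.trans ih₂

lemma arity_eq_of_equiv {a b : PreTree D T} (h : a ≈ b) : a.arity = b.arity :=
  eq_of_equiv arity (fun a b h => by cases h <;> simp [arity]) h

lemma numVertices_eq_of_equiv {a b : PreTree D T} (h : a ≈ b) :
    a.numVertices = b.numVertices := by
  refine eq_of_equiv numVertices (fun a b h => ?_) h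
  induction h with
  | swap d l₁ l₂ p q => simp only [numVertices, numVerticesL_append, numVerticesL]; omega
  | congr d l₁ l₂ t s s' _ ih => simp only [numVertices, numVerticesL_append, numVerticesL, ih]

lemma mk_addChild_eq {a b : PreTree D T} (p : T × PreTree D T) (h : a ≈ b) :
    (⟦addChild p a⟧ : TypedTree D T) = ⟦addChild p b⟧ := by
  refine eq_of_equiv (fun a => (⟦addChild p a⟧ : TypedTree D T)) (fun a b h => ?_) h
  refine Quotient.sound (Relation.EqvGen.rel _ _ ?_)
  cases h with
  | swap d l₁ l₂ q r => exact Swap.swap d (p :: l₁) l₂ q r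
  | congr d l₁ l₂ t s s' h => exact Swap.congr d (p :: l₁) l₂ t s s' h

lemma mk_addChild_eq_left (t : T) {s s' : PreTree D T} (a : PreTree D T) (h : s ≈ s') :
    (⟦addChild (t, s) a⟧ : TypedTree D T) = ⟦addChild (t, s') a⟧ := by
  refine eq_of_equiv (fun s => (⟦addChild (t, s) a⟧ : TypedTree D T)) (fun s s' h => ?_) h
  cases a with
  | node d l => exact Quotient.sound (Relation.EqvGen.rel _ _ (Swap.congr d [] l t s s' h))

mutual
lemma numVertices_of_mem_graftAll (t : T) (s' : PreTree D T) :
    ∀ (s r : PreTree D T), r ∈ graftAll t s' s →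
      r.numVertices = s.numVertices + s'.numVertices
  | .node d l, r, hr => by
    simp only [graftAll, List.mem_cons, List.mem_map] at hr
    rcases hr with rfl | ⟨l', hl', rfl⟩
    · simp only [numVertices, numVerticesL]; omega
    · have := numVerticesL_of_mem_graftAllL t s' l l' hl'
      simp only [numVertices]; omega
lemma numVerticesL_of_mem_graftAllL (t : T) (s' : PreTree D T) :
    ∀ (l l' : List (T × PreTree D T)), l' ∈ graftAllL t s' l →
      numVerticesL l' = numVerticesL l + s'.numVertices
  | [], l', hl' => by simp [graftAllL] at hl'
  | (u, c) :: rest, l', hl' => by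
    simp only [graftAllL, List.mem_append, List.mem_map] at hl'
    rcases hl' with ⟨c', hc', rfl⟩ | ⟨r, hr, rfl⟩
    · have := numVertices_of_mem_graftAll t s' c c' hc'
      simp only [numVerticesL]; omega
    · have := numVerticesL_of_mem_graftAllL t s' rest r hr
      simp only [numVerticesL]; omega
end

lemma length_of_mem_graftAllL (t : T) (s' : PreTree D T) (l l' : List (T × PreTree D T))
    (h : l' ∈ graftAllL t s' l) : l'.length = l.length := by
  induction l generalizing l' with
  | nil => simp [graftAllL] at h
  | cons p rest ih =>
    simp only [graftAllL, List.mem_append, List.mem_map] at h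
    rcases h with ⟨c', hc', rfl⟩ | ⟨r, hr, rfl⟩
    · simp
    · simp [ih r hr]

end Invariants

section Eval

variable {K : Type} [Field K] {A : Type} [AddCommGroup A] [Module K A]
  (mul : T → A →ₗ[K] A →ₗ[K] A) (a : D → A)

mutual
/-- The value of a tree in a multiple prelie algebra, given the values of the decorations. -/
def eval : PreTree D T → A
  | .node d l => brace mul (a d) l.length (evalL l)
/-- The list of typed values of the trees of a forest. -/
def evalL : List (T × PreTree D T) → List (T × A)
  | [] => []
  | (u, c) :: rest => (u, eval c) :: evalL rest
end

lemma evalL_append (l₁ l₂ : List (T × PreTree D T)) :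
    evalL mul a (l₁ ++ l₂) = evalL mul a l₁ ++ evalL mul a l₂ := by
  induction l₁ with
  | nil => simp [evalL]
  | cons p l ih => simp [evalL, ih]

lemma eval_eq_of_equiv
    (hmul : ∀ (t t' : T) (x y z : A),
      mul t' x (mul t y z) - mul t (mul t' x y) z =
        mul t x (mul t' z y) - mul t' (mul t x z) y)
    {s s' : PreTree D T} (h : s ≈ s') : eval mul a s = eval mul a s' := by
  refine eq_of_equiv (eval mul a) (fun s s' h => ?_) h
  induction h with
  | swap d l₁ l₂ p q =>
    simp only [eval, evalL_append, evalL, List.length_append, List.length_cons]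
    exact swapInvariant_brace hmul _ _ _ _ _ _
  | congr d l₁ l₂ t s s' _ ih =>
    simp only [eval, evalL_append, evalL, List.length_append, List.length_cons, ih]

mutual
lemma sum_eval_graftAll (t : T) (s' : PreTree D T) :
    ∀ s : PreTree D T,
      ((graftAll t s' s).map (eval mul a)).sum = mul t (eval mul a s) (eval mul a s')
  | .node d l => by
    have h := sum_evalL_graftAllL t s' l (brace mul (a d) l.length)
      (multiAdditive_brace mul (a d) l.length)
    have h' : ((graftAllL t s' l).map fun l' => eval mul a (.node d l')) =
        (graftAllL t s' l).map fun l' => brace mul (a d) l.length (evalL mul a l') := by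
      refine List.map_congr_left fun l' hl' => ?_
      rw [eval, length_of_mem_graftAllL t s' l l' hl']
    simp only [graftAll, List.map_cons, List.map_map, List.sum_cons, Function.comp_def, h', h]
    simp [eval, evalL, brace]
lemma sum_evalL_graftAllL (t : T) (s' : PreTree D T) :
    ∀ (l : List (T × PreTree D T)) (f : List (T × A) → A), MultiAdditive f →
      ((graftAllL t s' l).map fun l' => f (evalL mul a l')).sum =
        derivSum mul (t, eval mul a s') f (evalL mul a l)
  | [], f, _ => by simp [graftAllL, evalL, derivSum]
  | (u, c) :: rest, f, hf => by
    have h := sum_eval_graftAll t s' c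
    have h' := sum_evalL_graftAllL t s' rest _ (hf.cons (u, eval mul a c))
    simp only [graftAllL, List.map_append, List.map_map, List.sum_append, Function.comp_def,
      evalL, derivSum, h', ← h, hf.map_sum]
end

end Eval

end PreTree

section Bullet

variable {K : Type} [Field K] {D T : Type} {A : Type} [AddCommGroup A] [Module K A]

lemma bulletL_single_single (t : T) (x y : TypedTree D T) :
    bulletL K t (Finsupp.single x (1 : K)) (Finsupp.single y (1 : K)) =
      ((PreTree.graftAll t y.out x.out).map
        fun r => Finsupp.single (⟦r⟧ : TypedTree D T) (1 : K)).sum := by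
  simp [bulletL]

lemma map_bulletL_of_single (φ : gDT K D T →ₗ[K] A) (mul : T → A →ₗ[K] A →ₗ[K] A) (t : T)
    (h : ∀ x y : TypedTree D T,
      φ (bulletL K t (Finsupp.single x 1) (Finsupp.single y 1)) =
        mul t (φ (Finsupp.single x 1)) (φ (Finsupp.single y 1))) (x y : gDT K D T) :
    φ (bulletL K t x y) = mul t (φ x) (φ y) := by
  have : (bulletL K t).compr₂ φ = (mul t).compl₁₂ φ φ := by
    ext x y
    simpa using h x y
  exact LinearMap.congr_fun₂ this x y

/-- A morphism of multiple prelie algebras on `g_{D,𝒯}` is determined by its values on the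
single-vertex trees. -/
lemma gDT_hom_ext {φ ψ : gDT K D T →ₗ[K] A} (mul : T → A →ₗ[K] A →ₗ[K] A)
    (hφ : ∀ (t : T) (x y : gDT K D T), φ (bulletL K t x y) = mul t (φ x) (φ y))
    (hψ : ∀ (t : T) (x y : gDT K D T), ψ (bulletL K t x y) = mul t (ψ x) (ψ y))
    (h : ∀ d : D, φ (Finsupp.single (⟦PreTree.node d []⟧ : TypedTree D T) (1 : K)) =
      ψ (Finsupp.single (⟦PreTree.node d []⟧ : TypedTree D T) (1 : K))) : φ = ψ := by
  have key : ∀ (n k : ℕ) (s : PreTree D T), s.numVertices = n → s.arity = k →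
      φ (Finsupp.single (⟦s⟧ : TypedTree D T) (1 : K)) =
        ψ (Finsupp.single (⟦s⟧ : TypedTree D T) (1 : K)) := by
    intro n
    induction n using Nat.strong_induction_on with
    | _ n ihn =>
    intro k
    induction k with
    | zero =>
      rintro ⟨d, l⟩ - hl
      obtain rfl : l = [] := List.length_eq_zero_iff.mp hl
      exact h d
    | succ k ihk =>
      rintro ⟨d, _ | ⟨⟨t, c⟩, l⟩⟩ hn hk
      · simp [PreTree.arity] at hk
      have hx := Quotient.mk_out (s := preTreeSetoid D T) (PreTree.node d l)
      have hc := Quotient.mk_out (s := preTreeSetoid D T) c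
      have hxn := PreTree.numVertices_eq_of_equiv hx
      have hxk := PreTree.arity_eq_of_equiv hx
      have hcn := PreTree.numVertices_eq_of_equiv hc
      have hs : (⟦PreTree.node d ((t, c) :: l)⟧ : TypedTree D T) =
          ⟦PreTree.addChild (t, (⟦c⟧ : TypedTree D T).out)
            (⟦PreTree.node d l⟧ : TypedTree D T).out⟧ :=
        ((PreTree.mk_addChild_eq_left t _ hc).trans (PreTree.mk_addChild_eq (t, c) hx)).symm
      have hcpos : 0 < c.numVertices := by cases c; simp only [PreTree.numVertices]; omega
      simp only [PreTree.numVertices, PreTree.numVerticesL, PreTree.arity,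
        List.length_cons] at hn hk hxn hxk
      have hbullet : φ (bulletL K t (Finsupp.single ⟦PreTree.node d l⟧ 1)
          (Finsupp.single ⟦c⟧ 1)) = ψ (bulletL K t (Finsupp.single ⟦PreTree.node d l⟧ 1)
          (Finsupp.single ⟦c⟧ 1)) := by
        rw [hφ, hψ, ihn (PreTree.node d l).numVertices
          (by simp only [PreTree.numVertices]; omega) _ _ rfl rfl,
          ihn c.numVertices (by omega) _ _ rfl rfl]
      rw [bulletL_single_single] at hbullet
      rw [hs]
      generalize (⟦PreTree.node d l⟧ : TypedTree D T).out = x at *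
      generalize (⟦c⟧ : TypedTree D T).out = c' at *
      obtain ⟨d', l₀⟩ := x
      simp only [PreTree.graftAll, List.map_cons, List.sum_cons, map_add, map_list_sum,
        List.map_map, Function.comp_def] at hbullet
      have htail : ((PreTree.graftAllL t c' l₀).map fun l' =>
            φ (Finsupp.single (⟦PreTree.node d' l'⟧ : TypedTree D T) (1 : K))) =
          (PreTree.graftAllL t c' l₀).map fun l' =>
            ψ (Finsupp.single (⟦PreTree.node d' l'⟧ : TypedTree D T) (1 : K)) := by
        refine List.map_congr_left fun l' hl' => ihk _ ?_ ?_
        · have := PreTree.numVerticesL_of_mem_graftAllL t c' l₀ l' hl'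
          simp only [PreTree.numVertices] at hxn ⊢
          omega
        · have := PreTree.length_of_mem_graftAllL t c' l₀ l' hl'
          simp only [PreTree.arity] at hxk ⊢
          omega
      rw [htail] at hbullet
      exact add_right_cancel hbullet
  ext x
  induction x using Quotient.inductionOn with
  | _ s => simpa using key _ _ s rfl rfl

end Bullet

/-- `g_{D,𝒯}` is the free `𝒯`-multiple prelie algebra generated by `D`:
for any `𝒯`-multiple prelie algebra `(A, (•_t))` and any family `(a_d)_{d∈D}` in `A`,
there is a unique linear map `φ : g_{D,𝒯} → A` commuting with all the products `•_t` and
sending the single-vertex tree decorated by `d` to `a_d`. -/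
theorem gDT_free_multiple_prelie (K : Type) [Field K] (D T : Type) [Nonempty D] [Nonempty T]
    (A : Type) [AddCommGroup A] [Module K A] (mul : T → A →ₗ[K] A →ₗ[K] A)
    (hmul : ∀ (t t' : T) (x y z : A),
      mul t' x (mul t y z) - mul t (mul t' x y) z =
        mul t x (mul t' z y) - mul t' (mul t x z) y)
    (a : D → A) :
    ∃! φ : gDT K D T →ₗ[K] A,
      (∀ (t : T) (x y : gDT K D T), φ (bulletL K t x y) = mul t (φ x) (φ y)) ∧
      (∀ d : D, φ (Finsupp.single (⟦PreTree.node d []⟧ : TypedTree D T) (1 : K)) = a d) := by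
  let φ : gDT K D T →ₗ[K] A := Finsupp.lift A K (TypedTree D T)
    (Quotient.lift (PreTree.eval mul a) fun _ _ h => PreTree.eval_eq_of_equiv mul a hmul h)
  have hφ : ∀ s : PreTree D T,
      φ (Finsupp.single (⟦s⟧ : TypedTree D T) (1 : K)) = PreTree.eval mul a s := by
    intro s
    simp [φ]
  have hφmul : ∀ (t : T) (x y : gDT K D T), φ (bulletL K t x y) = mul t (φ x) (φ y) := by
    intro t
    refine map_bulletL_of_single φ mul t fun x y => ?_
    rw [bulletL_single_single, map_list_sum, List.map_map]
    simp only [Function.comp_def, hφ]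
    rw [PreTree.sum_eval_graftAll, ← hφ, ← hφ, Quotient.out_eq, Quotient.out_eq]
  have hφone : ∀ d : D,
      φ (Finsupp.single (⟦PreTree.node d []⟧ : TypedTree D T) (1 : K)) = a d := by
    intro d
    simp [hφ, PreTree.eval, PreTree.evalL, brace]
  exact ⟨φ, ⟨hφmul, hφone⟩, fun ψ hψ =>
    gDT_hom_ext mul hψ.1 hφmul fun d => (hψ.2 d).trans (hφone d).symm⟩
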